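/- arXiv:2101.08168 — 2 statements merged into one kernel-verified Lean document; each statement's English description precedes it below -/
import Mathlib

section
/- For every β > −1 there exists a constant c_β > 0 such that for all k ≥ 1 and all λ ∈ [0,1], λ^{(β+1)/4} · |C_k^{((β+1)/2)}(√(1−λ))| / C_k^{((β+1)/2)}(1) ≤ c_β · k^{−(β+1)/2}. -/
/-- Gegenbauer (ultraspherical) polynomials `C_n^{(a)}`. -/
noncomputable def gegenbauer (a : ℝ) : ℕ → ℝ → ℝ
  | 0, _ => 1
  | 1, x => 2 * a * x
  | (n + 2), x =>
      (2 * (((n : ℝ) + 2) + a - 1) * x * gegenbauer a (n + 1) x -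
        (((n : ℝ) + 2) + 2 * a - 2) * gegenbauer a n x) / ((n : ℝ) + 2)

theorem geg_one_succ (a : ℝ) (ha : 0 < a) (k : ℕ) :
    0 < gegenbauer a k 1 ∧
      ((k : ℝ) + 1) * gegenbauer a (k + 1) 1 = (k + 2 * a) * gegenbauer a k 1 := by
  induction k with
  | zero => simp [gegenbauer]
  | succ k ih =>
    obtain ⟨h0, h1⟩ := ih
    have hk : (0 : ℝ) ≤ k := Nat.cast_nonneg k
    have hpos : 0 < gegenbauer a (k + 1) 1 := by
      have : 0 < ((k : ℝ) + 1) * gegenbauer a (k + 1) 1 := by rw [h1]; positivity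
      exact pos_of_mul_pos_right this (by positivity)
    refine ⟨hpos, ?_⟩
    have e : gegenbauer a (k + 1 + 1) 1 = (2 * (((k : ℝ) + 2) + a - 1) * 1 * gegenbauer a (k + 1) 1 -
        (((k : ℝ) + 2) + 2 * a - 2) * gegenbauer a k 1) / ((k : ℝ) + 2) := by
      rw [gegenbauer]
    rw [e]
    push_cast
    field_simp
    linear_combination ((k : ℝ) + 2) * h1

theorem geg_ratio_rec (a : ℝ) (ha : 0 < a) (x : ℝ) (k : ℕ) :
    ((k : ℝ) + 1 + 2 * a) * (gegenbauer a (k + 2) x / gegenbauer a (k + 2) 1) =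
      2 * ((k : ℝ) + 1 + a) * x * (gegenbauer a (k + 1) x / gegenbauer a (k + 1) 1) -
        ((k : ℝ) + 1) * (gegenbauer a k x / gegenbauer a k 1) := by
  obtain ⟨h0, e0⟩ := geg_one_succ a ha k
  obtain ⟨h1, e1⟩ := geg_one_succ a ha (k + 1)
  obtain ⟨h2, -⟩ := geg_one_succ a ha (k + 2)
  have hk : (0 : ℝ) ≤ k := Nat.cast_nonneg k
  have e : gegenbauer a (k + 2) x = (2 * (((k : ℝ) + 2) + a - 1) * x * gegenbauer a (k + 1) x -
        (((k : ℝ) + 2) + 2 * a - 2) * gegenbauer a k x) / ((k : ℝ) + 2) := by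
    rw [gegenbauer]
  push_cast at e1
  have f1 : gegenbauer a (k + 1) 1 = (k + 2 * a) * gegenbauer a k 1 / ((k : ℝ) + 1) := by
    field_simp; linarith
  have f2 : gegenbauer a (k + 2) 1 =
      (k + 1 + 2 * a) * ((k + 2 * a) * gegenbauer a k 1 / ((k : ℝ) + 1)) / ((k : ℝ) + 2) := by
    rw [← f1]; field_simp; linarith
  rw [f2, f1, e]
  have p1 : (k : ℝ) + 2 * a ≠ 0 := by positivity
  have p2 : (k : ℝ) + 1 + 2 * a ≠ 0 := by positivity
  have p3 := h0.ne'
  field_simp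
  ring

noncomputable def gw (a : ℝ) : ℕ → ℝ
  | 0 => 1
  | (n + 1) => gw a n * (1 + a / (n + a))

theorem gw_pos (a : ℝ) (ha : 0 < a) (k : ℕ) : 0 < gw a k := by
  induction k with
  | zero => simp [gw]
  | succ k ih => rw [gw]; positivity

theorem gw_growth_step (a : ℝ) (ha : 0 < a) (k : ℕ) :
    gw a k * ((k + 1 : ℝ) + 2 * a) ^ a ≤ gw a (k + 1) * ((k : ℝ) + 2 * a) ^ a := by
  have hk : (0 : ℝ) ≤ k := Nat.cast_nonneg k
  have hw := gw_pos a ha k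
  set M : ℝ := k + 2 * a with hM
  have hMp : 0 < M := by positivity
  have h1 : ((k + 1 : ℝ) + 2 * a) = M * (1 + 1 / M) := by field_simp; rw [hM]; ring
  have h2 : (1 + 1 / M) ^ a ≤ Real.exp (a / M) := by
    have : 1 + 1 / M ≤ Real.exp (1 / M) := by linarith [Real.add_one_le_exp (1 / M)]
    calc (1 + 1 / M) ^ a ≤ (Real.exp (1 / M)) ^ a :=
          Real.rpow_le_rpow (by positivity) this ha.le
      _ = Real.exp (a / M) := by rw [← Real.exp_mul]; congr 1; ring
  have h3 : Real.exp (a / M) ≤ 1 + a / (k + a) := by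
    have h4 : 1 - a / M ≤ Real.exp (-(a / M)) := by linarith [Real.add_one_le_exp (-(a / M))]
    have h5 : 1 + a / (k + a) = (1 - a / M)⁻¹ := by
      have : 1 - a / M = (k + a) / M := by field_simp; rw [hM]; ring
      rw [this, inv_div]; field_simp; rw [hM]; ring
    have h6 : 0 < 1 - a / M := by
      have : 1 - a / M = (k + a) / M := by field_simp; rw [hM]; ring
      rw [this]; positivity
    rw [h5, ← inv_inv (Real.exp (a / M)), ← Real.exp_neg]
    exact inv_anti₀ h6 h4
  rw [h1, Real.mul_rpow hMp.le (by positivity), gw]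
  have := h2.trans h3
  have hMa : 0 < M ^ a := by positivity
  calc gw a k * (M ^ a * (1 + 1 / M) ^ a) ≤ gw a k * (M ^ a * (1 + a / (k + a))) := by gcongr
    _ = _ := by ring

theorem gw_growth (a : ℝ) (ha : 0 < a) (K n : ℕ) (h : K ≤ n) :
    gw a K * ((n : ℝ) + 2 * a) ^ a ≤ gw a n * ((K : ℝ) + 2 * a) ^ a := by
  induction n, h using Nat.le_induction with
  | base => exact le_rfl
  | succ n hn ih =>
    have h1 := gw_growth_step a ha n
    have hp : 0 < ((n : ℝ) + 2 * a) ^ a := by positivity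
    have hp1 : 0 < ((n : ℝ) + 1 + 2 * a) ^ a := by positivity
    have hp2 : 0 < ((K : ℝ) + 2 * a) ^ a := by positivity
    push_cast
    refine le_of_mul_le_mul_right ?_ hp
    calc gw a K * ((n : ℝ) + 1 + 2 * a) ^ a * ((n : ℝ) + 2 * a) ^ a
        = (gw a K * ((n : ℝ) + 2 * a) ^ a) * ((n : ℝ) + 1 + 2 * a) ^ a := by ring
      _ ≤ (gw a n * ((K : ℝ) + 2 * a) ^ a) * ((n : ℝ) + 1 + 2 * a) ^ a := by gcongr
      _ = (gw a n * ((n : ℝ) + 1 + 2 * a) ^ a) * ((K : ℝ) + 2 * a) ^ a := by ring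
      _ ≤ (gw a (n + 1) * ((n : ℝ) + 2 * a) ^ a) * ((K : ℝ) + 2 * a) ^ a := by gcongr
      _ = _ := by ring

/-- basic energy decay -/
theorem energy_r (a : ℝ) (ha : 0 < a) (x s : ℝ) (hs : s ^ 2 + x ^ 2 = 1) (r : ℕ → ℝ)
    (h0 : r 0 = 1) (h1 : r 1 = x)
    (hr : ∀ k : ℕ, ((k : ℝ) + 1 + 2 * a) * r (k + 2) =
      2 * ((k : ℝ) + 1 + a) * x * r (k + 1) - ((k : ℝ) + 1) * r k) (k : ℕ) :
    (r (k + 1) - x * r k) ^ 2 + s ^ 2 * r k ^ 2 ≤ s ^ 2 := by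
  induction k with
  | zero => simp [h0, h1]
  | succ k ih =>
    refine le_trans ?_ ih
    have hs' : s ^ 2 = 1 - x ^ 2 := by linarith
    have hk : (0 : ℝ) < (k : ℝ) + 1 + a := by positivity
    have key : ((k : ℝ) + 1 + a) * (((r (k + 1) - x * r k) ^ 2 + s ^ 2 * r k ^ 2) -
        ((r (k + 2) - x * r (k + 1)) ^ 2 + s ^ 2 * r (k + 1) ^ 2)) =
        a * (r (k + 2) - r k) ^ 2 := by
      rw [hs']
      linear_combination (-(r (k + 2) - r k)) * hr k
    have : 0 ≤ a * (r (k + 2) - r k) ^ 2 := by positivity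
    rw [← key] at this
    have := nonneg_of_mul_nonneg_right this hk
    linarith

theorem q_rec (a : ℝ) (ha : 0 < a) (x : ℝ) (r : ℕ → ℝ)
    (hr : ∀ k : ℕ, ((k : ℝ) + 1 + 2 * a) * r (k + 2) =
      2 * ((k : ℝ) + 1 + a) * x * r (k + 1) - ((k : ℝ) + 1) * r k) (k : ℕ) :
    gw a (k + 2) * r (k + 2) = 2 * x * (gw a (k + 1) * r (k + 1)) -
      (1 + a * (1 - a) / ((k + a) * (k + 1 + a))) * (gw a k * r k) := by
  have hk : (0 : ℝ) ≤ k := Nat.cast_nonneg k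
  have e : r (k + 2) = (2 * ((k : ℝ) + 1 + a) * x * r (k + 1) - ((k : ℝ) + 1) * r k) /
      ((k : ℝ) + 1 + 2 * a) := by
    rw [← hr k]; field_simp
  rw [e, gw, gw]
  push_cast
  have p1 : (k : ℝ) + a ≠ 0 := by positivity
  have p2 : (k : ℝ) + 1 + a ≠ 0 := by positivity
  have p3 : (k : ℝ) + 1 + 2 * a ≠ 0 := by positivity
  field_simp
  ring

/-- energy of the renormalised sequence -/
theorem energy_q_step (a : ℝ) (ha : 0 < a) (x s : ℝ) (hs0 : 0 < s) (hs : s ^ 2 + x ^ 2 = 1)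
    (q : ℕ → ℝ)
    (hq : ∀ k : ℕ, q (k + 2) = 2 * x * q (k + 1) -
      (1 + a * (1 - a) / ((k + a) * (k + 1 + a))) * q k) (k : ℕ) :
    ((q (k + 2) - x * q (k + 1)) ^ 2 + s ^ 2 * q (k + 1) ^ 2) *
        Real.exp (2 * (a * |1 - a| / s) / (k + 1 + a)) ≤
      ((q (k + 1) - x * q k) ^ 2 + s ^ 2 * q k ^ 2) *
        Real.exp (2 * (a * |1 - a| / s) / (k + a)) := by
  have hk : (0 : ℝ) ≤ k := Nat.cast_nonneg k
  have hs' : s ^ 2 = 1 - x ^ 2 := by linarith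
  set ε : ℝ := a * (1 - a) / ((k + a) * (k + 1 + a)) with hε
  set E : ℝ := (q (k + 1) - x * q k) ^ 2 + s ^ 2 * q k ^ 2 with hE
  have hE0 : 0 ≤ E := by positivity
  have hE' : E = (x * q (k + 1) - q k) ^ 2 + s ^ 2 * q (k + 1) ^ 2 := by
    rw [hE, hs']; ring
  have e1 : (q (k + 2) - x * q (k + 1)) ^ 2 + s ^ 2 * q (k + 1) ^ 2 =
      E - 2 * ε * (q k * (x * q (k + 1) - q k)) + ε ^ 2 * q k ^ 2 := by
    rw [hq k, hE']; ring
  set δ : ℝ := |ε| / s with hδ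
  have hδ0 : 0 ≤ δ := by positivity
  have b1 : |q k| * s ≤ √E := by
    apply Real.le_sqrt_of_sq_le
    rw [mul_pow, sq_abs, hE]; nlinarith [sq_nonneg (q (k + 1) - x * q k)]
  have b2 : |x * q (k + 1) - q k| ≤ √E := by
    apply Real.le_sqrt_of_sq_le
    rw [sq_abs, hE']; nlinarith [sq_nonneg (s * q (k + 1))]
  have b1' : |q k| ≤ √E / s := by rwa [le_div_iff₀ hs0]
  have hsq : √E * √E = E := Real.mul_self_sqrt hE0
  have c1 : -(2 * ε * (q k * (x * q (k + 1) - q k))) ≤ 2 * δ * E := by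
    calc -(2 * ε * (q k * (x * q (k + 1) - q k)))
        ≤ |2 * ε * (q k * (x * q (k + 1) - q k))| := neg_le_abs _
      _ = 2 * |ε| * (|q k| * |x * q (k + 1) - q k|) := by simp [abs_mul]
      _ ≤ 2 * |ε| * (√E / s * √E) := by gcongr
      _ = 2 * δ * (√E * √E) := by rw [hδ]; ring
      _ = 2 * δ * E := by rw [hsq]
  have c2 : ε ^ 2 * q k ^ 2 ≤ δ ^ 2 * E := by
    calc ε ^ 2 * q k ^ 2 = |ε| ^ 2 * |q k| ^ 2 := by simp
      _ ≤ |ε| ^ 2 * (√E / s) ^ 2 := by gcongr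
      _ = δ ^ 2 * (√E * √E) := by rw [hδ]; ring
      _ = _ := by rw [hsq]
  have c3 : (q (k + 2) - x * q (k + 1)) ^ 2 + s ^ 2 * q (k + 1) ^ 2 ≤ E * (1 + δ) ^ 2 := by
    rw [e1]; linarith
  have c4 : (1 + δ) ^ 2 ≤ Real.exp (2 * δ) := by
    have : 1 + δ ≤ Real.exp δ := by linarith [Real.add_one_le_exp δ]
    calc (1 + δ) ^ 2 ≤ Real.exp δ ^ 2 := by gcongr
      _ = Real.exp (2 * δ) := by rw [← Real.exp_nat_mul]; norm_num
  have hεa : |ε| = a * |1 - a| / ((k + a) * (k + 1 + a)) := by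
    rw [hε, abs_div, abs_mul, abs_of_pos ha,
      abs_of_pos (show (0 : ℝ) < (k + a) * (k + 1 + a) by positivity)]
  have c5 : 2 * δ + 2 * (a * |1 - a| / s) / (k + 1 + a) = 2 * (a * |1 - a| / s) / (k + a) := by
    rw [hδ, hεa]
    have p1 : (k : ℝ) + a ≠ 0 := by positivity
    have p2 : (k : ℝ) + 1 + a ≠ 0 := by positivity
    field_simp
    ring
  calc _ ≤ E * Real.exp (2 * δ) * Real.exp (2 * (a * |1 - a| / s) / (k + 1 + a)) := by
        gcongr
        exact c3.trans (by gcongr)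
    _ = _ := by rw [mul_assoc, ← Real.exp_add, c5]

theorem energy_q (a : ℝ) (ha : 0 < a) (x s : ℝ) (hs0 : 0 < s) (hs : s ^ 2 + x ^ 2 = 1)
    (q : ℕ → ℝ)
    (hq : ∀ k : ℕ, q (k + 2) = 2 * x * q (k + 1) -
      (1 + a * (1 - a) / ((k + a) * (k + 1 + a))) * q k) (K n : ℕ) (h : K ≤ n) :
    ((q (n + 1) - x * q n) ^ 2 + s ^ 2 * q n ^ 2) ≤
      ((q (K + 1) - x * q K) ^ 2 + s ^ 2 * q K ^ 2) *
        Real.exp (2 * (a * |1 - a| / s) / (K + a)) := by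
  have main : ((q (n + 1) - x * q n) ^ 2 + s ^ 2 * q n ^ 2) *
        Real.exp (2 * (a * |1 - a| / s) / (n + a)) ≤
      ((q (K + 1) - x * q K) ^ 2 + s ^ 2 * q K ^ 2) *
        Real.exp (2 * (a * |1 - a| / s) / (K + a)) := by
    induction n, h using Nat.le_induction with
    | base => exact le_rfl
    | succ n hn ih =>
      refine le_trans ?_ ih
      have := energy_q_step a ha x s hs0 hs q hq n
      push_cast
      exact this
  refine le_trans ?_ main
  have : 1 ≤ Real.exp (2 * (a * |1 - a| / s) / (n + a)) := by
    apply Real.one_le_exp; positivity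
  exact le_mul_of_one_le_right (by positivity) this

set_option maxHeartbeats 1000000 in
theorem decay_abs (a : ℝ) (ha : 0 < a) : ∃ c : ℝ, 0 < c ∧
    ∀ (x s : ℝ) (r : ℕ → ℝ), 0 < s → 0 ≤ x → s ^ 2 + x ^ 2 = 1 → r 0 = 1 → r 1 = x →
    (∀ k : ℕ, ((k : ℝ) + 1 + 2 * a) * r (k + 2) =
      2 * ((k : ℝ) + 1 + a) * x * r (k + 1) - ((k : ℝ) + 1) * r k) →
    ∀ n : ℕ, ((n : ℝ) * s) ^ a * |r n| ≤ c := by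
  set B : ℝ := a * |1 - a| with hB
  set D : ℝ := √(((2 + a) ^ 2 + 1) * Real.exp (2 * B * (1 + a) / a)) with hD
  refine ⟨2 ^ a + D * (2 * (1 + 2 * a)) ^ a, by positivity, ?_⟩
  intro x s r hs0 hx0 hs h0 h1 hr n
  have hx1 : x ≤ 1 := by nlinarith
  have hs1 : s ≤ 1 := by nlinarith
  have hN := energy_r a ha x s hs r h0 h1 hr
  have hr1 : ∀ k, |r k| ≤ 1 := by
    intro k
    rw [← sq_le_one_iff_abs_le_one]
    have h2 : 0 < s ^ 2 := by positivity
    have := hN k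
    have h3 : s ^ 2 * r k ^ 2 ≤ s ^ 2 * 1 := by nlinarith [sq_nonneg (r (k + 1) - x * r k)]
    exact le_of_mul_le_mul_left h3 h2
  -- K + 1 = ceil (1/s)
  obtain ⟨K, hK1, hK2⟩ : ∃ K : ℕ, 1 ≤ ((K : ℝ) + 1) * s ∧ ((K : ℝ) + 1) * s ≤ 2 := by
    have hp : 0 < ⌈1 / s⌉₊ := Nat.ceil_pos.mpr (by positivity)
    obtain ⟨K, hK⟩ := Nat.exists_eq_succ_of_ne_zero hp.ne'
    have e1 : 1 / s ≤ (⌈1 / s⌉₊ : ℝ) := Nat.le_ceil _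
    have e2 : (⌈1 / s⌉₊ : ℝ) < 1 / s + 1 := Nat.ceil_lt_add_one (by positivity)
    rw [hK] at e1 e2
    push_cast at e1 e2
    refine ⟨K, ?_, ?_⟩
    · rwa [div_le_iff₀ hs0] at e1
    · have : ((K : ℝ) + 1) * s ≤ (1 / s + 1) * s := by gcongr
      have e3 : (1 / s + 1) * s = 1 + s := by field_simp
      linarith
  have hDp : 0 ≤ D * (2 * (1 + 2 * a)) ^ a := by positivity
  have h2p : 0 ≤ (2 : ℝ) ^ a := by positivity
  rcases le_or_gt n (K + 1) with hn | hn
  · have hn' : (n : ℝ) ≤ K + 1 := by exact_mod_cast hn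
    have : (n : ℝ) * s ≤ 2 := le_trans (by gcongr) hK2
    have e : ((n : ℝ) * s) ^ a * |r n| ≤ 2 ^ a * 1 := by
      gcongr
      exact hr1 n
    linarith
  -- main case
  have hKn : K ≤ n := by omega
  have hn0 : (0 : ℝ) < n := by exact_mod_cast (by omega : 0 < n)
  have hE := energy_q a ha x s hs0 hs (fun k => gw a k * r k)
    (fun k => q_rec a ha x r hr k) K n hKn
  have hw := gw_pos a ha (K + 1)
  have hw0 := gw_pos a ha K
  have hwn := gw_pos a ha n
  set W := gw a (K + 1) with hW
  have hWe : W = gw a K * (1 + a / (K + a)) := by rw [hW, gw]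
  have hwW : gw a K ≤ W := by
    rw [hWe]; apply le_mul_of_one_le_right hw0.le
    have : 0 ≤ a / ((K : ℝ) + a) := by positivity
    linarith
  have hdiff : W - gw a K ≤ W * ((1 + a) * s) := by
    have e1 : W - gw a K = gw a K * (a / (K + a)) := by rw [hWe]; ring
    have e2 : a / ((K : ℝ) + a) ≤ (1 + a) * s := by
      rw [div_le_iff₀ (by positivity)]
      have : a * 1 ≤ a * (((K : ℝ) + 1) * s) := by gcongr
      have : 0 ≤ (K : ℝ) * s := by positivity
      have : 0 ≤ a ^ 2 * s := by positivity
      linarith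
    rw [e1]
    gcongr
  have hrK : |r (K + 1) - x * r K| ≤ s := by
    apply abs_le_of_sq_le_sq _ hs0.le
    have : 0 ≤ s ^ 2 * r K ^ 2 := by positivity
    linarith [hN K]
  have hA : |W * r (K + 1) - x * (gw a K * r K)| ≤ W * s * (2 + a) := by
    have e : W * r (K + 1) - x * (gw a K * r K) =
        W * (r (K + 1) - x * r K) + x * (W - gw a K) * r K := by ring
    rw [e]
    calc _ ≤ |W * (r (K + 1) - x * r K)| + |x * (W - gw a K) * r K| := abs_add_le _ _
      _ = W * |r (K + 1) - x * r K| + x * (W - gw a K) * |r K| := by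
        rw [abs_mul, abs_mul, abs_mul, abs_of_pos hw, abs_of_nonneg hx0,
          abs_of_nonneg (sub_nonneg.mpr hwW)]
      _ ≤ W * s + 1 * (W * ((1 + a) * s)) * 1 := by
        have := sub_nonneg.mpr hwW
        gcongr
        exact hr1 K
      _ = _ := by ring
  have hEK : (W * r (K + 1) - x * (gw a K * r K)) ^ 2 + s ^ 2 * (gw a K * r K) ^ 2 ≤
      W ^ 2 * s ^ 2 * ((2 + a) ^ 2 + 1) := by
    have e1 : (W * r (K + 1) - x * (gw a K * r K)) ^ 2 ≤ (W * s * (2 + a)) ^ 2 := by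
      rw [← sq_abs]; gcongr
    have e2 : (gw a K * r K) ^ 2 ≤ (W * 1) ^ 2 := by
      rw [← sq_abs, abs_mul, abs_of_pos hw0]; gcongr; exact hr1 K
    have e3 : s ^ 2 * (gw a K * r K) ^ 2 ≤ s ^ 2 * (W * 1) ^ 2 := by gcongr
    linarith
  have hexp : Real.exp (2 * (B / s) / (K + a)) ≤ Real.exp (2 * B * (1 + a) / a) := by
    apply Real.exp_le_exp.mpr
    have hB0 : 0 ≤ B := by positivity
    have e : 1 / (s * (K + a)) ≤ (1 + a) / a := by
      rw [div_le_div_iff₀ (by positivity) ha]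
      have : a * 1 ≤ a * (((K : ℝ) + 1) * s) := by gcongr
      have : 0 ≤ (K : ℝ) * s := by positivity
      have : 0 ≤ a ^ 2 * s := by positivity
      linarith
    calc 2 * (B / s) / (K + a) = 2 * B * (1 / (s * (K + a))) := by field_simp
      _ ≤ 2 * B * ((1 + a) / a) := by gcongr
      _ = _ := by ring
  have hqn : gw a n * |r n| ≤ W * D := by
    have e0 : s ^ 2 * (gw a n * r n) ^ 2 ≤
        W ^ 2 * s ^ 2 * ((2 + a) ^ 2 + 1) * Real.exp (2 * B * (1 + a) / a) := by
      refine le_trans ?_ (hE.trans (mul_le_mul hEK hexp (Real.exp_pos _).le (by positivity)))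
      exact le_add_of_nonneg_left (sq_nonneg _)
    have e1 : D ^ 2 = ((2 + a) ^ 2 + 1) * Real.exp (2 * B * (1 + a) / a) := by
      rw [hD, Real.sq_sqrt (by positivity)]
    have e2 : s ^ 2 * (gw a n * r n) ^ 2 ≤ s ^ 2 * (W * D) ^ 2 := by
      rw [mul_pow W D, e1]; linarith
    have e3 := le_of_mul_le_mul_left e2 (by positivity)
    have e4 := abs_le_of_sq_le_sq e3 (by positivity)
    rwa [abs_mul, abs_of_pos hwn] at e4
  have hgr : W * ((n : ℝ) + 2 * a) ^ a ≤ gw a n * ((K : ℝ) + 1 + 2 * a) ^ a := by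
    have hg0 := gw_growth a ha (K + 1) n (le_of_lt hn)
    rwa [Nat.cast_add, Nat.cast_one] at hg0
  have hgg : W * ((n : ℝ) * s) ^ a ≤ gw a n * (2 * (1 + 2 * a)) ^ a := by
    have e1 : ((n : ℝ) * s) ^ a ≤ ((n : ℝ) + 2 * a) ^ a * s ^ a := by
      rw [Real.mul_rpow hn0.le hs0.le]
      gcongr
      linarith
    have e2 : ((K : ℝ) + 1 + 2 * a) ^ a * s ^ a ≤ (2 * (1 + 2 * a)) ^ a := by
      rw [← Real.mul_rpow (by positivity) hs0.le]
      refine Real.rpow_le_rpow (by positivity) ?_ ha.le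
      have : a * s ≤ a * 1 := by gcongr
      linarith
    calc W * ((n : ℝ) * s) ^ a ≤ W * (((n : ℝ) + 2 * a) ^ a * s ^ a) := by gcongr
      _ = (W * ((n : ℝ) + 2 * a) ^ a) * s ^ a := by ring
      _ ≤ (gw a n * ((K : ℝ) + 1 + 2 * a) ^ a) * s ^ a := by gcongr
      _ = gw a n * (((K : ℝ) + 1 + 2 * a) ^ a * s ^ a) := by ring
      _ ≤ _ := by gcongr
  have hfin : ((n : ℝ) * s) ^ a * |r n| ≤ D * (2 * (1 + 2 * a)) ^ a := by
    refine le_of_mul_le_mul_left ?_ (mul_pos hw hwn)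
    calc W * gw a n * (((n : ℝ) * s) ^ a * |r n|)
        = (W * ((n : ℝ) * s) ^ a) * (gw a n * |r n|) := by ring
      _ ≤ (gw a n * (2 * (1 + 2 * a)) ^ a) * (W * D) := by gcongr
      _ = _ := by ring
  linarith

theorem gegenbauer_decay_estimate (β : ℝ) (hβ : -1 < β) :
    ∃ c : ℝ, 0 < c ∧ ∀ k : ℕ, 1 ≤ k → ∀ l ∈ Set.Icc (0 : ℝ) 1,
      l ^ ((β + 1) / 4) * |gegenbauer ((β + 1) / 2) k (Real.sqrt (1 - l))| /
          gegenbauer ((β + 1) / 2) k 1 ≤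
        c * (k : ℝ) ^ (-((β + 1) / 2)) := by
  have ha : 0 < (β + 1) / 2 := by linarith
  have h4 : (β + 1) / 4 = 1 / 2 * ((β + 1) / 2) := by ring
  rw [h4]
  set a := (β + 1) / 2 with haa
  obtain ⟨c, hc, H⟩ := decay_abs a ha
  refine ⟨c, hc, ?_⟩
  intro k hk l hl
  have hk0 : (0 : ℝ) < k := by exact_mod_cast hk
  rcases hl.1.eq_or_lt with h | h
  · rw [← h, Real.zero_rpow (by positivity)]
    simp only [zero_mul, zero_div]
    positivity
  have hpos : 0 < gegenbauer a k 1 := (geg_one_succ a ha k).1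
  have := H (√(1 - l)) (√l) (fun k => gegenbauer a k (√(1 - l)) / gegenbauer a k 1)
    (Real.sqrt_pos.mpr h) (Real.sqrt_nonneg _)
    (by rw [Real.sq_sqrt hl.1, Real.sq_sqrt (by linarith [hl.2])]; ring)
    (by simp [gegenbauer]) (by simp only [gegenbauer]; field_simp)
    (fun k => geg_ratio_rec a ha _ k) k
  rw [abs_div, abs_of_pos hpos, Real.mul_rpow hk0.le (Real.sqrt_nonneg _)] at this
  rw [Real.rpow_mul hl.1, ← Real.sqrt_eq_rpow, Real.rpow_neg hk0.le, ← div_eq_mul_inv,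
    le_div_iff₀ (by positivity)]
  calc _ = _ := by ring
    _ ≤ c := this
end

section
/- Let β > −1 and 0 < μ ≤ (β+1)/4. Then there exists a constant C > 0 (depending only on μ and β) such that for all k ≥ 1 and all λ ∈ [0,1], |r_k(λ)| · λ^μ ≤ C · k^{−2μ}. -/
/-- Momentum sequence `α_k = (k-1)/(k+β)`. -/
noncomputable def nesterovAlpha (β : ℝ) (k : ℕ) : ℝ := ((k : ℝ) - 1) / ((k : ℝ) + β)

/-- Residual polynomials of Nesterov's accelerated Landweber iteration. -/
noncomputable def nesterovRes (β : ℝ) : ℕ → ℝ → ℝ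
  | 0, _ => 1
  | 1, l => 1 - l
  | (k + 2), l =>
      (1 - l) * (nesterovRes β (k + 1) l +
        nesterovAlpha β (k + 1) * (nesterovRes β (k + 1) l - nesterovRes β k l))

noncomputable def auxA (v : ℝ) (n : ℕ) : ℝ := (n : ℝ) / ((n : ℝ) + 2 * v)

noncomputable def auxPD (v x : ℝ) : ℕ → ℝ × ℝ
  | 0 => (1, 0)
  | (n + 1) =>
      (x * (auxPD v x n).1 + (auxPD v x n).2,
        auxA v (n + 1) * (x * (auxPD v x n).2 - (1 - x ^ 2) * (auxPD v x n).1))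

lemma aux_rel (β x : ℝ) (k : ℕ) :
    nesterovRes β (k + 1) (1 - x ^ 2) = x ^ (k + 2) * (auxPD ((β + 1) / 2) x k).1 ∧
    nesterovRes β (k + 2) (1 - x ^ 2) = x ^ (k + 3) * (auxPD ((β + 1) / 2) x (k + 1)).1 := by
  induction k with
  | zero =>
    constructor
    · simp [nesterovRes, auxPD]
    · simp [nesterovRes, auxPD, nesterovAlpha]; ring
  | succ k ih =>
    refine ⟨ih.2, ?_⟩
    have h : nesterovRes β (k + 1 + 2) (1 - x ^ 2) = (1 - (1 - x ^ 2)) *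
      (nesterovRes β (k + 2) (1 - x ^ 2) + nesterovAlpha β (k + 1 + 1) *
        (nesterovRes β (k + 2) (1 - x ^ 2) - nesterovRes β (k + 1) (1 - x ^ 2))) := rfl
    have hA : nesterovAlpha β (k + 1 + 1) = auxA ((β + 1) / 2) (k + 1) := by
      unfold nesterovAlpha auxA
      push_cast
      congr 1 <;> ring
    rw [h, ih.1, ih.2, hA]
    simp only [auxPD]
    ring

lemma auxA_nonneg (v : ℝ) (hv : 0 < v) (n : ℕ) : 0 ≤ auxA v n := by
  unfold auxA; positivity

lemma auxA_le_one (v : ℝ) (hv : 0 < v) (n : ℕ) : auxA v n ≤ 1 := by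
  unfold auxA
  rw [div_le_one (by positivity)]
  linarith

lemma auxA_gap (v : ℝ) (hv : 0 < v) (n : ℕ) (hn : 1 ≤ n) : 1 - auxA v n ≤ 2 * v / n := by
  unfold auxA
  have h : (0 : ℝ) < n := by exact_mod_cast hn
  have e : 1 - (n : ℝ) / (n + 2 * v) = 2 * v / (n + 2 * v) := by field_simp; ring
  rw [e]
  gcongr
  linarith

lemma auxA_mono (v : ℝ) (hv : 0 < v) (n : ℕ) (hn : 1 ≤ n) :
    auxA v n ≤ auxA v (n + 1) ∧ auxA v (n + 1) - auxA v n ≤ 2 * v / (n : ℝ) ^ 2 := by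
  unfold auxA
  have h : (0 : ℝ) < n := by exact_mod_cast hn
  have e : ((n + 1 : ℕ) : ℝ) / ((n + 1 : ℕ) + 2 * v) - (n : ℝ) / (n + 2 * v)
      = 2 * v / ((n + 2 * v) * (n + 1 + 2 * v)) := by push_cast; field_simp; ring
  constructor
  · rw [← sub_nonneg, e]; positivity
  · rw [e]
    gcongr
    nlinarith

lemma auxA_delta (v : ℝ) (hv : 0 < v) (n : ℕ) (hn : 1 ≤ n) :
    2 * v / n - 6 * v ^ 2 / (n : ℝ) ^ 2 ≤ (1 - auxA v n ^ 2) / 2 := by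
  unfold auxA
  have h : (0 : ℝ) < n := by exact_mod_cast hn
  rw [← sub_nonneg]
  have e : (1 - ((n : ℝ) / (n + 2 * v)) ^ 2) / 2 - (2 * v / n - 6 * v ^ 2 / (n : ℝ) ^ 2)
      = (2 * v ^ 2 * (8 * n * v + 12 * v ^ 2)) / ((n : ℝ) ^ 2 * (n + 2 * v) ^ 2) := by
    field_simp; ring
  rw [e]; positivity

lemma aux_bound (v x : ℝ) (hv : 0 < v) (n : ℕ) :
    (1 - x ^ 2) * (auxPD v x n).1 ^ 2 + (auxPD v x n).2 ^ 2 ≤ 1 - x ^ 2 := by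
  induction n with
  | zero => simp [auxPD]
  | succ n ih =>
    simp only [auxPD]
    have h0 := auxA_nonneg v hv (n + 1)
    have h1 := auxA_le_one v hv (n + 1)
    set p := (auxPD v x n).1
    set d := (auxPD v x n).2
    set a := auxA v (n + 1)
    have : a ^ 2 ≤ 1 := by nlinarith
    have := mul_le_mul_of_nonneg_right this (sq_nonneg (x * d - (1 - x ^ 2) * p))
    rw [mul_pow]
    nlinarith

/-- quadratic corrector -/
noncomputable def auxW (x s P d : ℝ) : ℝ := (P ^ 2 - d ^ 2) / 2 - x / s * (P * d)

lemma auxW_bound (x s P d : ℝ) (hs : 0 < s) (hxs : x ^ 2 + s ^ 2 = 1) :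
    |auxW x s P d| ≤ (P ^ 2 + d ^ 2) / (2 * s) := by
  have e : auxW x s P d = (s * (P ^ 2 - d ^ 2) - x * (2 * P * d)) / (2 * s) := by
    unfold auxW; field_simp
  rw [e, abs_div, abs_of_pos (by positivity : 0 < 2 * s)]
  gcongr
  apply abs_le_of_sq_le_sq _ (by positivity)
  have : (P ^ 2 + d ^ 2) ^ 2 - (s * (P ^ 2 - d ^ 2) - x * (2 * P * d)) ^ 2
     = (x * (P ^ 2 - d ^ 2) + s * (2 * P * d)) ^ 2 := by
    have hx : x ^ 2 = 1 - s ^ 2 := by linarith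
    ring_nf
    simp only [hx]
    ring
  nlinarith [sq_nonneg (x * (P ^ 2 - d ^ 2) + s * (2 * P * d))]

lemma auxW_rot (x s P d : ℝ) (hs : 0 < s) (hxs : x ^ 2 + s ^ 2 = 1) :
    auxW x s (x * P + s * d) (x * d - s * P) - auxW x s P d
      = (x * P + s * d) ^ 2 - (x * d - s * P) ^ 2 := by
  unfold auxW
  have hx : s ^ 2 = 1 - x ^ 2 := by linarith
  field_simp
  have h3 : s ^ 3 = s * (1 - x ^ 2) := by rw [← hx]; ring
  ring_nf
  simp only [h3, hx]
  ring

lemma aux_sq0 (a : ℝ) (h0 : 0 ≤ a) (h1 : a ≤ 1) : 0 ≤ (1 - a ^ 2) / 2 := by nlinarith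

lemma aux_sq (a : ℝ) : (1 - a ^ 2) / 2 ≤ 1 - a := by nlinarith [sq_nonneg (a - 1)]

lemma aux_sq2 (a b : ℝ) (h0 : 0 ≤ a) (h1 : b ≤ 1) (h : a ≤ b) :
    0 ≤ (1 - a ^ 2) / 2 - (1 - b ^ 2) / 2 ∧ (1 - a ^ 2) / 2 - (1 - b ^ 2) / 2 ≤ b - a := by
  constructor <;> nlinarith

/-- one step, abstract -/
lemma aux_step (v x s P d a a' m : ℝ) (hv : 0 < v) (hs : 0 < s) (hs1 : s ≤ 1) (hx : 0 ≤ x)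
    (hxs : x ^ 2 + s ^ 2 = 1) (hm : 0 < m) (ha0 : 0 ≤ a) (ha1 : a ≤ 1) (ha1' : a' ≤ 1)
    (hg : 1 - a ≤ 2 * v / m) (hmono : a ≤ a') (hdiff : a' - a ≤ 2 * v / m ^ 2) :
    (x * P + s * d) ^ 2 + (a * (x * d - s * P)) ^ 2
      - (1 - a' ^ 2) / 2 * auxW x s (x * P + s * d) (a * (x * d - s * P))
    ≤ (1 - (1 - a ^ 2) / 2) * (P ^ 2 + d ^ 2 - (1 - a ^ 2) / 2 * auxW x s P d)
      + (10 * v ^ 2 + v) / (s * m ^ 2) * (P ^ 2 + d ^ 2) := by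
  have hrot := auxW_rot x s P d hs hxs
  have hb := auxW_bound x s P d hs hxs
  have hb' := auxW_bound x s (x * P + s * d) (x * d - s * P) hs hxs
  have hQ : (x * P + s * d) ^ 2 + (x * d - s * P) ^ 2 = P ^ 2 + d ^ 2 := by
    linear_combination (P ^ 2 + d ^ 2) * hxs
  rw [hQ] at hb'
  set P' := x * P + s * d
  set e := x * d - s * P
  set Q := P ^ 2 + d ^ 2
  have hQ0 : 0 ≤ Q := by positivity
  set W := auxW x s P d
  set W' := auxW x s P' e
  have hWd : W' - auxW x s P' (a * e) = -((1 - a ^ 2) / 2 * e ^ 2) - x / s * (1 - a) * (P' * e) := by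
    simp only [W', auxW]; ring
  set W2 := auxW x s P' (a * e)
  have hx1 : x ≤ 1 := by nlinarith
  have hD0 : 0 ≤ (1 - a ^ 2) / 2 := aux_sq0 a (by linarith) ha1
  have hD1 : (1 - a ^ 2) / 2 ≤ 2 * v / m := le_trans (aux_sq a) hg
  have hD0' : 0 ≤ (1 - a' ^ 2) / 2 := aux_sq0 a' (by linarith) ha1'
  have hD1' : (1 - a' ^ 2) / 2 ≤ 2 * v / m := le_trans (aux_sq a') (by linarith)
  have hDD := aux_sq2 a a' ha0 ha1' hmono
  have hDD0 := hDD.1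
  have hDD1 : (1 - a ^ 2) / 2 - (1 - a' ^ 2) / 2 ≤ 2 * v / m ^ 2 := le_trans hDD.2 hdiff
  set D := (1 - a ^ 2) / 2 with hD
  set D' := (1 - a' ^ 2) / 2
  have hvm : 0 < 2 * v / m := by positivity
  have t1 : -(D ^ 2 * W) ≤ (2 * v / m) ^ 2 * (Q / (2 * s)) := by
    have : -W ≤ Q / (2 * s) := by linarith [neg_abs_le W]
    calc -(D ^ 2 * W) = D ^ 2 * (-W) := by ring
      _ ≤ D ^ 2 * (Q / (2 * s)) := by gcongr
      _ ≤ _ := by gcongr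
  have t2 : (D - D') * W' ≤ 2 * v / m ^ 2 * (Q / (2 * s)) := by
    have : W' ≤ Q / (2 * s) := by linarith [le_abs_self W']
    calc (D - D') * W' ≤ (D - D') * (Q / (2 * s)) := by gcongr
      _ ≤ _ := by gcongr
  have t3' : W' - W2 ≤ (2 * v / m) * (2 * Q / s) := by
    rw [hWd]
    have h1 : -(P' * e) ≤ Q := by nlinarith [sq_nonneg (P' + e), sq_nonneg P', sq_nonneg e]
    have h2 : 0 ≤ D * e ^ 2 := by positivity
    have h4 : 0 ≤ x / s * (1 - a) := mul_nonneg (by positivity) (by linarith)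
    have h3 : x / s * (1 - a) * (-(P' * e)) ≤ 1 / s * (2 * v / m) * Q := by
      calc x / s * (1 - a) * (-(P' * e)) ≤ x / s * (1 - a) * Q := by gcongr
        _ ≤ 1 / s * (2 * v / m) * Q := by
          have : 0 ≤ 1 - a := by linarith
          gcongr
    have h5 : (2 * v / m) * (2 * Q / s) = 1 / s * (2 * v / m) * Q + 1 / s * (2 * v / m) * Q := by
      ring
    have h6 : 0 ≤ 1 / s * (2 * v / m) * Q := by positivity
    linarith
  have t3 : D' * (W' - W2) ≤ (2 * v / m) * ((2 * v / m) * (2 * Q / s)) := by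
    calc D' * (W' - W2) ≤ D' * ((2 * v / m) * (2 * Q / s)) := by gcongr
      _ ≤ _ := by gcongr
  have tot : (10 * v ^ 2 + v) / (s * m ^ 2) * Q = (2 * v / m) ^ 2 * (Q / (2 * s))
      + 2 * v / m ^ 2 * (Q / (2 * s)) + (2 * v / m) * ((2 * v / m) * (2 * Q / s)) := by
    field_simp; ring
  rw [tot]
  have ha2 : a ^ 2 = 1 - 2 * D := by rw [hD]; ring
  have key : P' ^ 2 + (a * e) ^ 2 - D' * W2 = (1 - D) * (Q - D * W) - D ^ 2 * W
      + (D - D') * W' + D' * (W' - W2) := by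
    rw [mul_pow, ha2]
    linear_combination (1 - D) * hQ - D * hrot
  linarith

/-- the corrected energy -/
noncomputable def auxV (v x s : ℝ) (n : ℕ) : ℝ :=
  (s * (auxPD v x n).1) ^ 2 + (auxPD v x n).2 ^ 2
    - (1 - auxA v (n + 1) ^ 2) / 2 * auxW x s (s * (auxPD v x n).1) (auxPD v x n).2

lemma auxV_bounds (v x s : ℝ) (hv : 0 < v) (hs : 0 < s) (hxs : x ^ 2 + s ^ 2 = 1) (n : ℕ)
    (hn : 2 * v ≤ n * s) :
    (s * (auxPD v x n).1) ^ 2 + (auxPD v x n).2 ^ 2 ≤ 2 * auxV v x s n ∧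
    auxV v x s n ≤ 2 * ((s * (auxPD v x n).1) ^ 2 + (auxPD v x n).2 ^ 2) := by
  unfold auxV
  have hb := auxW_bound x s (s * (auxPD v x n).1) (auxPD v x n).2 hs hxs
  set W := auxW x s (s * (auxPD v x n).1) (auxPD v x n).2
  set Q := (s * (auxPD v x n).1) ^ 2 + (auxPD v x n).2 ^ 2
  have hQ : 0 ≤ Q := by positivity
  have h0 := auxA_nonneg v hv (n + 1)
  have h1 := auxA_le_one v hv (n + 1)
  have hg := auxA_gap v hv (n + 1) (by omega)
  have hsm : 2 * v / ((n + 1 : ℕ) : ℝ) ≤ s := by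
    rw [div_le_iff₀ (by positivity)]; push_cast; nlinarith
  set a := auxA v (n + 1)
  have hD0 : 0 ≤ (1 - a ^ 2) / 2 := by nlinarith
  have hD1 : (1 - a ^ 2) / 2 ≤ s := by nlinarith
  have : |(1 - a ^ 2) / 2 * W| ≤ Q / 2 := by
    rw [abs_mul, abs_of_nonneg hD0]
    calc _ ≤ s * (Q / (2 * s)) := by gcongr
      _ = Q / 2 := by field_simp
  have := abs_le.1 this
  constructor <;> linarith

lemma auxV_step (v x s : ℝ) (hv : 0 < v) (hs : 0 < s) (hs1 : s ≤ 1) (hx : 0 ≤ x)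
    (hxs : x ^ 2 + s ^ 2 = 1) (n : ℕ) (hn : 2 * v ≤ n * s) :
    auxV v x s (n + 1) ≤
      Real.exp (-(2 * v / (n + 1 : ℝ)) + (26 * v ^ 2 + 2 * v) / (s * (n + 1 : ℝ) ^ 2))
        * auxV v x s n := by
  have hb := (auxV_bounds v x s hv hs hxs n hn).1
  have st := aux_step v x s (s * (auxPD v x n).1) (auxPD v x n).2 (auxA v (n + 1))
    (auxA v (n + 1 + 1)) ((n + 1 : ℕ) : ℝ) hv hs hs1 hx hxs (by positivity)
    (auxA_nonneg v hv _) (auxA_le_one v hv _) (auxA_le_one v hv _)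
    (auxA_gap v hv _ (by omega)) (auxA_mono v hv _ (by omega)).1 (auxA_mono v hv _ (by omega)).2
  have hdel := auxA_delta v hv (n + 1) (by omega)
  have e1 : s * (auxPD v x (n + 1)).1 = x * (s * (auxPD v x n).1) + s * (auxPD v x n).2 := by
    simp only [auxPD]; ring
  have e2 : (auxPD v x (n + 1)).2
      = auxA v (n + 1) * (x * (auxPD v x n).2 - s * (s * (auxPD v x n).1)) := by
    have : 1 - x ^ 2 = s ^ 2 := by linarith
    simp only [auxPD, this]; ring
  rw [← e1, ← e2] at st
  change auxV v x s (n + 1) ≤ (1 - (1 - auxA v (n + 1) ^ 2) / 2) * auxV v x s n + _ at st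
  have hQ0 : 0 ≤ (s * (auxPD v x n).1) ^ 2 + (auxPD v x n).2 ^ 2 := by positivity
  set Q := (s * (auxPD v x n).1) ^ 2 + (auxPD v x n).2 ^ 2
  set V := auxV v x s n
  have hV0 : 0 ≤ V := by linarith
  push_cast at st hdel
  set m : ℝ := (n : ℝ) + 1
  have hm : 0 < m := by positivity
  have h6 : 6 * v ^ 2 / m ^ 2 ≤ 6 * v ^ 2 / (s * m ^ 2) := by
    gcongr
    nlinarith [sq_nonneg m]
  have hE : (10 * v ^ 2 + v) / (s * m ^ 2) * Q ≤ (10 * v ^ 2 + v) / (s * m ^ 2) * (2 * V) := by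
    gcongr
  set D := (1 - auxA v (n + 1) ^ 2) / 2
  have hexp := Real.add_one_le_exp (-(2 * v / m) + (26 * v ^ 2 + 2 * v) / (s * m ^ 2))
  have hsplit : (26 * v ^ 2 + 2 * v) / (s * m ^ 2)
      = 2 * ((10 * v ^ 2 + v) / (s * m ^ 2)) + 6 * v ^ 2 / (s * m ^ 2) := by ring
  calc auxV v x s (n + 1) ≤ (1 - D + 2 * ((10 * v ^ 2 + v) / (s * m ^ 2))) * V := by linarith
    _ ≤ _ := by
      apply mul_le_mul_of_nonneg_right _ hV0
      linarith

noncomputable def auxL (v x s : ℝ) (n : ℕ) : ℝ :=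
  auxV v x s n * ((n + 1 : ℝ) ^ (2 * v) * Real.exp ((26 * v ^ 2 + 2 * v) / (s * n)))

lemma auxL_step (v x s : ℝ) (hv : 0 < v) (hs : 0 < s) (hs1 : s ≤ 1) (hx : 0 ≤ x)
    (hxs : x ^ 2 + s ^ 2 = 1) (n : ℕ) (hn1 : 1 ≤ n) (hn : 2 * v ≤ n * s) :
    auxL v x s (n + 1) ≤ auxL v x s n := by
  have h0 : (0 : ℝ) < n := by exact_mod_cast hn1
  have hb := (auxV_bounds v x s hv hs hxs n hn).1
  have hV0 : 0 ≤ auxV v x s n := by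
    have : 0 ≤ (s * (auxPD v x n).1) ^ 2 + (auxPD v x n).2 ^ 2 := by positivity
    linarith
  have st := auxV_step v x s hv hs hs1 hx hxs n hn
  unfold auxL
  push_cast
  set M := 26 * v ^ 2 + 2 * v
  have hM : 0 < M := by positivity
  set V := auxV v x s n
  have hpow : ((n : ℝ) + 1 + 1) ^ (2 * v) ≤ (n + 1 : ℝ) ^ (2 * v) * Real.exp (2 * v / (n + 1 : ℝ)) := by
    have h1 : (n : ℝ) + 1 + 1 ≤ (n + 1) * Real.exp (1 / (n + 1 : ℝ)) := by
      have := Real.add_one_le_exp (1 / (n + 1 : ℝ))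
      calc (n : ℝ) + 1 + 1 = (n + 1) * (1 / (n + 1 : ℝ) + 1) := by field_simp; ring
        _ ≤ _ := by gcongr
    calc ((n : ℝ) + 1 + 1) ^ (2 * v) ≤ ((n + 1) * Real.exp (1 / (n + 1 : ℝ))) ^ (2 * v) := by
          gcongr
      _ = _ := by
        rw [Real.mul_rpow (by positivity) (by positivity), ← Real.exp_mul]
        congr 2; ring
  have hexp : M / (s * (n + 1 : ℝ) ^ 2) + M / (s * (n + 1 : ℝ)) ≤ M / (s * n) := by
    have : M / (s * n) - (M / (s * (n + 1 : ℝ) ^ 2) + M / (s * (n + 1 : ℝ)))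
       = M / (s * n * (n + 1 : ℝ) ^ 2) := by field_simp; ring
    have h2 : 0 ≤ M / (s * n * (n + 1 : ℝ) ^ 2) := by positivity
    linarith
  calc auxV v x s (n + 1) * (((n : ℝ) + 1 + 1) ^ (2 * v) * Real.exp (M / (s * (n + 1 : ℝ))))
      ≤ (Real.exp (-(2 * v / (n + 1 : ℝ)) + M / (s * (n + 1 : ℝ) ^ 2)) * V) *
        (((n + 1 : ℝ) ^ (2 * v) * Real.exp (2 * v / (n + 1 : ℝ))) * Real.exp (M / (s * (n + 1 : ℝ)))) := by
        gcongr
    _ = V * ((n + 1 : ℝ) ^ (2 * v) * Real.exp (M / (s * (n + 1 : ℝ) ^ 2) + M / (s * (n + 1 : ℝ)))) := by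
        have : Real.exp (M / (s * (n + 1 : ℝ) ^ 2) + M / (s * (n + 1 : ℝ)))
          = Real.exp (-(2 * v / (n + 1 : ℝ)) + M / (s * (n + 1 : ℝ) ^ 2)) *
            Real.exp (2 * v / (n + 1 : ℝ)) * Real.exp (M / (s * (n + 1 : ℝ))) := by
          rw [← Real.exp_add, ← Real.exp_add]; congr 1; ring
        rw [this]; ring
    _ ≤ _ := by gcongr

lemma aux_decay (v : ℝ) (hv : 0 < v) : ∃ C : ℝ, 0 < C ∧ ∀ x s : ℝ, 0 < s → s ≤ 1 → 0 ≤ x →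
    x ^ 2 + s ^ 2 = 1 → ∀ n : ℕ, 1 + 2 * v ≤ n * s →
      (auxPD v x n).1 ^ 2 * ((n + 1 : ℝ) * s) ^ (2 * v) ≤ C := by
  refine ⟨4 * ((3 + 2 * v) ^ (2 * v) * Real.exp (26 * v ^ 2 + 2 * v)), by positivity, ?_⟩
  intro x s hs hs1 hx hxs n hn
  set N := ⌈(1 + 2 * v) / s⌉₊ with hN
  have hN1 : (1 + 2 * v) / s ≤ N := Nat.le_ceil _
  have hN2 : (N : ℝ) < (1 + 2 * v) / s + 1 := Nat.ceil_lt_add_one (by positivity)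
  have hNs : 1 + 2 * v ≤ N * s := by rwa [div_le_iff₀ hs] at hN1
  have hNn : N ≤ n := by
    apply Nat.ceil_le.2
    rwa [div_le_iff₀ hs]
  have hNpos : 1 ≤ N := Nat.ceil_pos.2 (by positivity)
  have hL : auxL v x s n ≤ auxL v x s N := by
    clear hn
    induction n, hNn using Nat.le_induction with
    | base => exact le_rfl
    | succ k hk ih =>
      refine le_trans (auxL_step v x s hv hs hs1 hx hxs k (by omega) ?_) ih
      have : (N : ℝ) ≤ k := by exact_mod_cast hk
      nlinarith
  have hbN := (auxV_bounds v x s hv hs hxs N (by linarith)).2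
  have hbn := (auxV_bounds v x s hv hs hxs n (by linarith)).1
  have hE := aux_bound v x hv N
  have hs2 : 1 - x ^ 2 = s ^ 2 := by linarith
  rw [hs2] at hE
  have hVN : auxV v x s N ≤ 2 * s ^ 2 := by nlinarith
  have hNpos' : (0 : ℝ) < N := by exact_mod_cast hNpos
  have hVn : s ^ 2 * (auxPD v x n).1 ^ 2 ≤ 2 * auxV v x s n := by nlinarith [sq_nonneg (auxPD v x n).2]
  have hn0 : (0 : ℝ) ≤ n := by positivity
  have hLN : auxL v x s N * s ^ (2 * v) ≤
      2 * s ^ 2 * ((3 + 2 * v) ^ (2 * v) * Real.exp (26 * v ^ 2 + 2 * v)) := by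
    unfold auxL
    have h1 : ((N + 1 : ℝ)) ^ (2 * v) * s ^ (2 * v) ≤ (3 + 2 * v) ^ (2 * v) := by
      rw [← Real.mul_rpow (by positivity) hs.le]
      gcongr
      have : (N : ℝ) * s ≤ ((1 + 2 * v) / s + 1) * s := by gcongr
      have e : ((1 + 2 * v) / s + 1) * s = 1 + 2 * v + s := by field_simp
      linarith
    have h2 : (26 * v ^ 2 + 2 * v) / (s * N) ≤ 26 * v ^ 2 + 2 * v := by
      apply div_le_self (by positivity)
      linarith
    calc _ = auxV v x s N * (((N + 1 : ℝ)) ^ (2 * v) * s ^ (2 * v) *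
          Real.exp ((26 * v ^ 2 + 2 * v) / (s * N))) := by ring
      _ ≤ _ := by gcongr
  have hLn : s ^ 2 * (auxPD v x n).1 ^ 2 * (n + 1 : ℝ) ^ (2 * v) ≤ 2 * auxL v x s n := by
    have hVn0 : 0 ≤ 2 * auxV v x s n := le_trans (by positivity) hVn
    unfold auxL
    have h1 : 1 ≤ Real.exp ((26 * v ^ 2 + 2 * v) / (s * n)) := Real.one_le_exp (by positivity)
    calc _ ≤ 2 * auxV v x s n * ((n + 1 : ℝ) ^ (2 * v)) := by gcongr
      _ ≤ 2 * auxV v x s n * ((n + 1 : ℝ) ^ (2 * v)) * Real.exp ((26 * v ^ 2 + 2 * v) / (s * n)) :=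
        le_mul_of_one_le_right (by positivity) h1
      _ = _ := by ring
  rw [Real.mul_rpow (by positivity) hs.le]
  have hsv : 0 ≤ s ^ (2 * v) := by positivity
  refine le_of_mul_le_mul_left ?_ (by positivity : 0 < s ^ 2)
  calc s ^ 2 * ((auxPD v x n).1 ^ 2 * ((n + 1 : ℝ) ^ (2 * v) * s ^ (2 * v)))
      = (s ^ 2 * (auxPD v x n).1 ^ 2 * (n + 1 : ℝ) ^ (2 * v)) * s ^ (2 * v) := by ring
    _ ≤ (2 * auxL v x s N) * s ^ (2 * v) := mul_le_mul_of_nonneg_right (by linarith) hsv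
    _ ≤ _ := by linarith

theorem nesterov_residual_decay_low (β : ℝ) (hβ : -1 < β) (μ : ℝ) (hμ : 0 < μ)
    (hμβ : μ ≤ (β + 1) / 4) :
    ∃ C : ℝ, 0 < C ∧ ∀ k : ℕ, 1 ≤ k → ∀ l ∈ Set.Icc (0 : ℝ) 1,
      |nesterovRes β k l| * l ^ μ ≤ C * (k : ℝ) ^ (-(2 * μ)) := by
  have hv : 0 < (β + 1) / 2 := by linarith
  have hrel := aux_rel β
  have hvμ : 4 * μ ≤ 2 * ((β + 1) / 2) := by linarith
  generalize (β + 1) / 2 = v at *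
  obtain ⟨C, hC, hdec⟩ := aux_decay v hv
  refine ⟨(2 + 2 * v) ^ (2 * μ) + (C + 1), by positivity, ?_⟩
  rintro k hk l ⟨hl0, hl1⟩
  obtain ⟨n, rfl⟩ : ∃ n, k = n + 1 := ⟨k - 1, by omega⟩
  have hk0 : (0 : ℝ) < ((n + 1 : ℕ) : ℝ) := by positivity
  rw [Real.rpow_neg hk0.le, ← div_eq_mul_inv, le_div_iff₀ (by positivity)]
  rcases hl0.eq_or_lt with h | hl
  · rw [← h, Real.zero_rpow hμ.ne']
    simp; positivity
  set s := √l with hs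
  set x := √(1 - l) with hx
  have hs0 : 0 < s := Real.sqrt_pos.2 hl
  have hs2 : s ^ 2 = l := Real.sq_sqrt hl0
  have hx2 : x ^ 2 = 1 - l := Real.sq_sqrt (by linarith)
  have hx0 : 0 ≤ x := Real.sqrt_nonneg _
  have hx1 : x ≤ 1 := by nlinarith
  have hs1 : s ≤ 1 := by nlinarith
  have hr := (hrel x n).1
  rw [show 1 - x ^ 2 = l by linarith] at hr
  have hrp : |nesterovRes β (n + 1) l| ≤ |(auxPD v x n).1| := by
    rw [hr, abs_mul, abs_of_nonneg (by positivity : 0 ≤ x ^ (n + 2))]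
    exact mul_le_of_le_one_left (abs_nonneg _) (pow_le_one₀ hx0 hx1)
  have hp1 : |(auxPD v x n).1| ≤ 1 := by
    have hb := aux_bound v x hv n
    rw [show 1 - x ^ 2 = s ^ 2 by linarith] at hb
    apply abs_le_of_sq_le_sq _ (by norm_num)
    refine le_of_mul_le_mul_left ?_ (by positivity : 0 < s ^ 2)
    nlinarith [sq_nonneg (auxPD v x n).2]
  have hlpow : l ^ μ = s ^ (2 * μ) := by
    rw [← hs2, ← Real.rpow_natCast, ← Real.rpow_mul hs0.le]; norm_num
  set p := (auxPD v x n).1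
  have hcomb : l ^ μ * ((n + 1 : ℕ) : ℝ) ^ (2 * μ) = ((n + 1 : ℝ) * s) ^ (2 * μ) := by
    rw [hlpow, Real.mul_rpow (by positivity) hs0.le]; push_cast; ring
  rw [mul_assoc, hcomb]
  set y := (n + 1 : ℝ) * s with hy
  have hy0 : 0 < y := by positivity
  have hyp : 0 ≤ y ^ (2 * μ) := by positivity
  have hA : 0 ≤ (2 + 2 * v) ^ (2 * μ) := by positivity
  refine le_trans (mul_le_mul_of_nonneg_right hrp hyp) ?_
  by_cases hc : 1 + 2 * v ≤ n * s
  · have hd := hdec x s hs0 hs1 hx0 (by linarith) n hc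
    have hy1 : 1 ≤ y := by rw [hy]; nlinarith
    have hsq : (|p| * y ^ (2 * μ)) ^ 2 ≤ C := by
      rw [mul_pow, sq_abs, ← Real.rpow_natCast (y ^ (2 * μ)), ← Real.rpow_mul hy0.le]
      refine le_trans ?_ hd
      refine mul_le_mul_of_nonneg_left ?_ (sq_nonneg p)
      exact Real.rpow_le_rpow_of_exponent_le hy1 (by push_cast; linarith)
    nlinarith [sq_nonneg (|p| * y ^ (2 * μ) - 1)]
  · have : y ^ (2 * μ) ≤ (2 + 2 * v) ^ (2 * μ) := by
      gcongr
      rw [hy]; nlinarith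
    have := mul_le_of_le_one_left hyp hp1
    linarith
end
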